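/- Termination of approximate value-set iteration (Lemma 4.12): Define the sequence 𝒱̂^0, 𝒱̂^1, … of value-set functions by 𝒱̂^0(s) = neigh_ξ(B) for all s ∈ S and 𝒱̂^{k+1} = Φ̂(𝒱̂^k). Then the sequence is decreasing (𝒱̂^{k+1} ⊆ 𝒱̂^k for all k), there exists K ≤ |S|·(1/ξ + 2)^{n+1} with 𝒱̂^{K+1} = 𝒱̂^K, and the resulting 𝒱 = 𝒱̂^K satisfies 𝒱 = Φ̂(𝒱) and 𝒱 ⊇ 𝒱*. -/

import Mathlib

open Finset

/-- A probability mass function on a finite type, as a predicate. -/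
def IsDist {X : Type*} [Fintype X] (f : X → ℝ) : Prop :=
  (∀ x, 0 ≤ f x) ∧ ∑ x, f x = 1

/-- Data of a stochastic game with a principal (player `0`) and `n` agents
(players `1,…,n`): initial state, discount factor, transition function and
reward functions. -/
structure Game (S A : Type*) (n : ℕ) where
  sInit : S
  gamma : ℝ
  p : S → (Fin (n + 1) → A) → S → ℝ
  r : Fin (n + 1) → S → (Fin (n + 1) → A) → ℝ

/-- Validity of the game data: `γ ∈ [0,1)`, transitions are probability
distributions, and rewards lie in `[-(1-γ)/2, (1-γ)/2]`. -/
def Game.Valid {S A : Type*} [Fintype S] {n : ℕ} (G : Game S A n) : Prop :=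
  0 ≤ G.gamma ∧ G.gamma < 1 ∧ (∀ s a, IsDist (G.p s a)) ∧
    ∀ i s a, |G.r i s a| ≤ (1 - G.gamma) / 2

/-- Histories: finite sequences of (state, recommended joint action, played joint action). -/
abbrev Hist (S A : Type*) (n : ℕ) :=
  List (S × (Fin (n + 1) → A) × (Fin (n + 1) → A))

/-- A (history-dependent) correlation policy assigns a probability distribution on
joint actions to every history and current state. -/
def IsPolicy {S A : Type*} [Fintype A] {n : ℕ}
    (π : Hist S A n → S → (Fin (n + 1) → A) → ℝ) : Prop :=
  ∀ σ s, IsDist (π σ s)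

/-- The trivial deviation plan (no deviation). -/
def noDev {S A : Type*} {n : ℕ} : Hist S A n → S → A → A := fun _ _ a => a

/-- `IsValueFn G π i ρ V Q` says that `V` and `Q` are bounded functions satisfying
the Bellman-type recursion defining the V- and Q-values induced by the policy `π`
together with the deviation plan `ρ` of agent `i`. -/
def IsValueFn {S A : Type*} [Fintype S] [Fintype A] {n : ℕ}
    (G : Game S A n) (π : Hist S A n → S → (Fin (n + 1) → A) → ℝ)
    (i : Fin (n + 1)) (ρ : Hist S A n → S → A → A)
    (V : Hist S A n → S → Fin (n + 1) → ℝ)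
    (Q : Hist S A n → S → (Fin (n + 1) → A) → Fin (n + 1) → ℝ) : Prop :=
  (∃ C : ℝ, ∀ σ s j, |V σ s j| ≤ C) ∧
  (∀ σ s j, V σ s j = ∑ a : Fin (n + 1) → A, π σ s a * Q σ s a j) ∧
  (∀ σ s (a : Fin (n + 1) → A) j,
    Q σ s a j =
      G.r j s (Function.update a i (ρ σ s (a i))) +
        G.gamma * ∑ s', G.p s (Function.update a i (ρ σ s (a i))) s' *
          V (σ ++ [(s, a, Function.update a i (ρ σ s (a i)))]) s' j)

/-- `π` is a `δ`-correlated equilibrium: it is a policy, and for every agent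
`i ∈ {1,…,n}`, every history, state and recommended action, no deviation plan
improves the agent's conditional value by more than `δ`. -/
def IsCE {S A : Type*} [Fintype S] [Fintype A] [DecidableEq A] {n : ℕ}
    (G : Game S A n) (δ : ℝ)
    (π : Hist S A n → S → (Fin (n + 1) → A) → ℝ) : Prop :=
  IsPolicy π ∧
  ∀ V Q, IsValueFn G π 0 noDev V Q →
    ∀ i : Fin (n + 1), i ≠ 0 →
      ∀ (ρ : Hist S A n → S → A → A) Vρ Qρ, IsValueFn G π i ρ Vρ Qρ →
        ∀ (σ : Hist S A n) (s : S) (a : A),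
          ∑ av ∈ univ.filter (fun av : Fin (n + 1) → A => av i = a),
              π σ s av * Q σ s av i ≥
            ∑ av ∈ univ.filter (fun av : Fin (n + 1) → A => av i = a),
              π σ s av * Qρ σ s av i - δ

/-- A value vector `v` is `δ`-inducible at state `s` if `v = V^π(s)` for some `δ`-CE `π`. -/
def Inducible {S A : Type*} [Fintype S] [Fintype A] [DecidableEq A] {n : ℕ}
    (G : Game S A n) (δ : ℝ) (s : S) (v : Fin (n + 1) → ℝ) : Prop :=
  ∃ π V Q, IsCE G δ π ∧ IsValueFn G π 0 noDev V Q ∧ V [] s = v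

/-- The inducible value set `𝒱*(s)`: all values inducible (by exact CEs) at `s`. -/
def Vstar {S A : Type*} [Fintype S] [Fintype A] [DecidableEq A] {n : ℕ}
    (G : Game S A n) : S → Set (Fin (n + 1) → ℝ) :=
  fun s => {v | Inducible G 0 s v}

/-- One-step Bellman value of a stage distribution `pb` and onward values `w`. -/
def Bellman {S A : Type*} [Fintype S] [Fintype A] {n : ℕ}
    (G : Game S A n) (s : S) (pb : (Fin (n + 1) → A) → ℝ)
    (w : (Fin (n + 1) → A) → (Fin (n + 1) → A) → S → Fin (n + 1) → ℝ) :
    Fin (n + 1) → ℝ :=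
  fun j => ∑ a : Fin (n + 1) → A,
    pb a * (G.r j s a + G.gamma * ∑ s', G.p s a s' * w a a s' j)

/-- The incentive-compatibility constraint for a stage distribution `pb` and
onward values `w` at state `s`. -/
def ICC {S A : Type*} [Fintype S] [Fintype A] [DecidableEq A] {n : ℕ}
    (G : Game S A n) (s : S) (pb : (Fin (n + 1) → A) → ℝ)
    (w : (Fin (n + 1) → A) → (Fin (n + 1) → A) → S → Fin (n + 1) → ℝ) : Prop :=
  ∀ i : Fin (n + 1), i ≠ 0 → ∀ a b : A,
    ∑ av ∈ univ.filter (fun av : Fin (n + 1) → A => av i = a),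
        pb av * (G.r i s av + G.gamma * ∑ s', G.p s av s' * w av av s' i) ≥
      ∑ av ∈ univ.filter (fun av : Fin (n + 1) → A => av i = a),
        pb av * (G.r i s (Function.update av i b) +
          G.gamma * ∑ s', G.p s (Function.update av i b) s' *
            w av (Function.update av i b) s' i)

/-- The feasible set `F_s(𝒱)` of pairs `(pb, w)`. -/
def Feas {S A : Type*} [Fintype S] [Fintype A] [DecidableEq A] {n : ℕ}
    (G : Game S A n) (s : S) (VS : S → Set (Fin (n + 1) → ℝ)) :
    Set (((Fin (n + 1) → A) → ℝ) ×
      ((Fin (n + 1) → A) → (Fin (n + 1) → A) → S → Fin (n + 1) → ℝ)) :=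
  {pw | IsDist pw.1 ∧ ICC G s pw.1 pw.2 ∧ ∀ a b s', pw.2 a b s' ∈ VS s'}

/-- The update map `Φ` on value-set functions. -/
def Phi {S A : Type*} [Fintype S] [Fintype A] [DecidableEq A] {n : ℕ}
    (G : Game S A n) (VS : S → Set (Fin (n + 1) → ℝ)) :
    S → Set (Fin (n + 1) → ℝ) :=
  fun s => {v | ∃ pb w, (pb, w) ∈ Feas G s VS ∧ v = Bellman G s pb w}

/-- The hypercube `B = [-1/2, 1/2]^{n+1}`. -/
def cube (n : ℕ) : Set (Fin (n + 1) → ℝ) := {v | ∀ i, |v i| ≤ 1 / 2}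

/-- The `ξ`-neighborhood (in `‖·‖_∞`) of a set of value vectors. -/
def neigh {n : ℕ} (ξ : ℝ) (X : Set (Fin (n + 1) → ℝ)) : Set (Fin (n + 1) → ℝ) :=
  {v' | ∃ v ∈ X, ∀ i, |v' i - v i| ≤ ξ}

/-- The grid `G_ξ` of vectors whose coordinates are integer multiples of `ξ`. -/
def grid (n : ℕ) (ξ : ℝ) : Set (Fin (n + 1) → ℝ) :=
  {v | ∀ i, ∃ m : ℤ, v i = ξ * (m : ℝ)}

/-- The approximate update map `Φ̂`. -/
def PhiHat {S A : Type*} [Fintype S] [Fintype A] [DecidableEq A] {n : ℕ}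
    (G : Game S A n) (ξ : ℝ) (VS : S → Set (Fin (n + 1) → ℝ)) :
    S → Set (Fin (n + 1) → ℝ) :=
  fun s => convexHull ℝ (neigh ξ (Phi G VS s) ∩ grid n ξ)

/-- Pushing a new state into a `λ`-step memory. -/
def shiftMem {S : Type*} {lam : ℕ} (m : Fin lam → Option S) (s : S) :
    Fin lam → Option S :=
  fun j => if (j : ℕ) = 0 then some s
    else m ⟨(j : ℕ) - 1, lt_of_le_of_lt (Nat.sub_le _ _) j.isLt⟩

/-- The `λ`-memory meta-game: meta-states record the current state together with
the previous `λ` states (with `none` as placeholder). -/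
def metaGame {S A : Type*} [DecidableEq S] {n : ℕ} (G : Game S A n) (lam : ℕ) :
    Game ((Fin lam → Option S) × S) A n where
  sInit := (fun _ => none, G.sInit)
  gamma := G.gamma
  p := fun x a x' => if x'.1 = shiftMem x.1 x.2 then G.p x.2 a x'.2 else 0
  r := fun i x a => G.r i x.2 a

/-- The game is `c`-turn-based with acting-player sets `I s` (always containing
the principal `0`): rewards and transitions only depend on acting players' actions. -/
def TurnBased {S A : Type*} {n : ℕ} (G : Game S A n) (c : ℕ)
    (I : S → Finset (Fin (n + 1))) : Prop :=
  (∀ s, (I s).card ≤ c) ∧ (∀ s, (0 : Fin (n + 1)) ∈ I s) ∧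
    ∀ s (a a' : Fin (n + 1) → A), (∀ i ∈ I s, a i = a' i) →
      (∀ j, G.r j s a = G.r j s a') ∧ ∀ s', G.p s a s' = G.p s a' s'

/-- The set of acting players recorded in a meta-state. -/
def metaI {S : Type*} {n lam : ℕ} (I : S → Finset (Fin (n + 1)))
    (x : (Fin lam → Option S) × S) : Finset (Fin (n + 1)) :=
  I x.2 ∪ Finset.univ.biUnion fun j : Fin lam => (x.1 j).elim ∅ I

/-- The relaxed neighborhood `neigh_{ξ₂}^{Ix}`: coordinates in `Ix` must stay
`ξ₂`-close, the others are only required to lie in `neigh_{ξ₂}(B)`. -/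
def neighI {n : ℕ} (ξ₂ : ℝ) (Ix : Finset (Fin (n + 1)))
    (X : Set (Fin (n + 1) → ℝ)) : Set (Fin (n + 1) → ℝ) :=
  {v' | v' ∈ neigh ξ₂ (cube n) ∧ ∃ v ∈ X, ∀ i ∈ Ix, |v' i - v i| ≤ ξ₂}

/-- The turn-based approximate update map `Φ^TB` on value-set functions of the
`λ`-memory meta-game. -/
def PhiTB {S A : Type*} [Fintype S] [Fintype A] [DecidableEq S] [DecidableEq A]
    {n : ℕ} (G : Game S A n) (lam : ℕ) (I : S → Finset (Fin (n + 1))) (ξ : ℝ)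
    (VS : ((Fin lam → Option S) × S) → Set (Fin (n + 1) → ℝ)) :
    ((Fin lam → Option S) × S) → Set (Fin (n + 1) → ℝ) :=
  fun x => convexHull ℝ
    (neighI (ξ / 2) (metaI I x) (Phi (metaGame G lam) VS x) ∩ grid n (ξ / 2))

/-- The auxiliary value function of the repeated 2×2 zero-sum subgame. -/
noncomputable def vfun (x y : ℝ) : ℝ :=
  (x * y + 2 * (1 - x) * (1 - y)) / (1 - x * y / 2 - (1 - x) * (1 - y) / 2)

/-! ### Weighted averages and the Bellman operator -/

theorem IsDist.abs_sum_mul_le {X : Type*} [Fintype X] {f g : X → ℝ} {c : ℝ} (hf : IsDist f)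
    (hg : ∀ x, |g x| ≤ c) : |∑ x, f x * g x| ≤ c :=
  calc |∑ x, f x * g x| ≤ ∑ x, |f x * g x| := abs_sum_le_sum_abs _ _
    _ ≤ ∑ x, f x * c := sum_le_sum fun x _ => by
        rw [abs_mul, abs_of_nonneg (hf.1 x)]
        exact mul_le_mul_of_nonneg_left (hg x) (hf.1 x)
    _ = c := by rw [← sum_mul, hf.2, one_mul]

section
variable {S A : Type*} {n : ℕ}

open Classical in
/-- The deviation plan that follows `ρ` after a first step `x` and is trivial elsewhere. -/
noncomputable def devAfter (x : S × (Fin (n + 1) → A) × (Fin (n + 1) → A))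
    (ρ : Hist S A n → S → A → A) : Hist S A n → S → A → A
  | [] => fun _ a => a
  | y :: τ => if y = x then ρ τ else fun _ a => a

theorem devAfter_noDev (x : S × (Fin (n + 1) → A) × (Fin (n + 1) → A)) :
    devAfter x noDev = (noDev : Hist S A n → S → A → A) := by
  funext σ
  cases σ with
  | nil => rfl
  | cons y τ => exact ite_self _

variable [Fintype S]

theorem Game.Valid.abs_step_le {G : Game S A n} (hG : G.Valid) {s : S} {j : Fin (n + 1)}
    {a : Fin (n + 1) → A} {w : S → ℝ} {c : ℝ} (hw : ∀ s', |w s'| ≤ 1 / 2 + c) :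
    |G.r j s a + G.gamma * ∑ s', G.p s a s' * w s'| ≤ 1 / 2 + G.gamma * c := by
  obtain ⟨h0, -, hp, hr⟩ := hG
  have h1 := mul_le_mul_of_nonneg_left ((hp s a).abs_sum_mul_le hw) h0
  have h2 := abs_add_le (G.r j s a) (G.gamma * ∑ s', G.p s a s' * w s')
  rw [abs_mul, abs_of_nonneg h0] at h2
  linarith [hr j s a]

variable [Fintype A]

theorem Game.Valid.abs_Bellman_le {G : Game S A n} (hG : G.Valid) {s : S}
    {pb : (Fin (n + 1) → A) → ℝ}
    {w : (Fin (n + 1) → A) → (Fin (n + 1) → A) → S → Fin (n + 1) → ℝ} {c : ℝ}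
    (hpb : IsDist pb) (hw : ∀ a b s' j, |w a b s' j| ≤ 1 / 2 + c) (j : Fin (n + 1)) :
    |Bellman G s pb w j| ≤ 1 / 2 + G.gamma * c :=
  hpb.abs_sum_mul_le fun a => hG.abs_step_le fun s' => hw a a s' j

/-! ### Inducible values are bounded and self-generating -/

theorem IsValueFn.abs_le_half {G : Game S A n} (hG : G.Valid)
    {π : Hist S A n → S → (Fin (n + 1) → A) → ℝ} (hπ : IsPolicy π) {i : Fin (n + 1)}
    {ρ : Hist S A n → S → A → A} {V : Hist S A n → S → Fin (n + 1) → ℝ}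
    {Q : Hist S A n → S → (Fin (n + 1) → A) → Fin (n + 1) → ℝ}
    (h : IsValueFn G π i ρ V Q) (σ : Hist S A n) (s : S) (j : Fin (n + 1)) :
    |V σ s j| ≤ 1 / 2 := by
  obtain ⟨⟨C, hC⟩, hV, hQ⟩ := h
  have key : ∀ k : ℕ, ∀ σ s j, |V σ s j| ≤ 1 / 2 + G.gamma ^ k * C := by
    intro k
    induction k with
    | zero => intro σ s j; linarith [hC σ s j]
    | succ k ih =>
      intro σ s j
      rw [hV, pow_succ', mul_assoc]
      refine (hπ σ s).abs_sum_mul_le fun a => ?_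
      rw [hQ]
      convert hG.abs_step_le fun s' => ih _ s' j
  have hlim : Filter.Tendsto (fun k : ℕ => 1 / 2 + G.gamma ^ k * C) Filter.atTop
      (nhds (1 / 2 + 0 * C)) :=
    ((tendsto_pow_atTop_nhds_zero_of_lt_one hG.1 hG.2.1).mul_const C).const_add _
  simpa using ge_of_tendsto' hlim fun k => key k σ s j

/-- A solution of the value recursion on nonempty histories extends to all histories. -/
theorem exists_isValueFn_of_cons {G : Game S A n}
    {π : Hist S A n → S → (Fin (n + 1) → A) → ℝ} {i : Fin (n + 1)}
    {ρ : Hist S A n → S → A → A} {V : Hist S A n → S → Fin (n + 1) → ℝ}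
    {Q : Hist S A n → S → (Fin (n + 1) → A) → Fin (n + 1) → ℝ}
    (hb : ∃ C : ℝ, ∀ x τ s j, |V (x :: τ) s j| ≤ C)
    (hV : ∀ x τ s j, V (x :: τ) s j = ∑ a, π (x :: τ) s a * Q (x :: τ) s a j)
    (hQ : ∀ x τ s (a : Fin (n + 1) → A) j, Q (x :: τ) s a j =
      G.r j s (Function.update a i (ρ (x :: τ) s (a i))) +
        G.gamma * ∑ s', G.p s (Function.update a i (ρ (x :: τ) s (a i))) s' *
          V (x :: (τ ++ [(s, a, Function.update a i (ρ (x :: τ) s (a i)))])) s' j) :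
    ∃ V' Q', IsValueFn G π i ρ V' Q' ∧ (∀ x τ, V' (x :: τ) = V (x :: τ)) ∧
      ∀ x τ, Q' (x :: τ) = Q (x :: τ) := by
  let Q' : Hist S A n → S → (Fin (n + 1) → A) → Fin (n + 1) → ℝ
    | [], s, a, j => G.r j s (Function.update a i (ρ [] s (a i))) +
        G.gamma * ∑ s', G.p s (Function.update a i (ρ [] s (a i))) s' *
          V [(s, a, Function.update a i (ρ [] s (a i)))] s' j
    | x :: τ, s, a, j => Q (x :: τ) s a j
  let V' : Hist S A n → S → Fin (n + 1) → ℝ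
    | [], s, j => ∑ a, π [] s a * Q' [] s a j
    | x :: τ, s, j => V (x :: τ) s j
  refine ⟨V', Q', ⟨?_, ?_, ?_⟩, fun _ _ => rfl, fun _ _ => rfl⟩
  · obtain ⟨C, hC⟩ := hb
    obtain ⟨D, hD⟩ := (Set.finite_range fun y : S × Fin (n + 1) => |V' [] y.1 y.2|).bddAbove
    refine ⟨max C D, ?_⟩
    rintro (_ | ⟨x, τ⟩) s j
    · exact (hD ⟨(s, j), rfl⟩).trans (le_max_right _ _)
    · exact (hC x τ s j).trans (le_max_left _ _)
  · rintro (_ | ⟨x, τ⟩) s j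
    · rfl
    · exact hV x τ s j
  · rintro (_ | ⟨x, τ⟩) s a j
    · rfl
    · exact hQ x τ s a j

theorem IsValueFn.of_noDev {G : Game S A n} {π : Hist S A n → S → (Fin (n + 1) → A) → ℝ}
    {i : Fin (n + 1)} {V : Hist S A n → S → Fin (n + 1) → ℝ}
    {Q : Hist S A n → S → (Fin (n + 1) → A) → Fin (n + 1) → ℝ}
    (h : IsValueFn G π i noDev V Q) (i' : Fin (n + 1)) : IsValueFn G π i' noDev V Q := by
  obtain ⟨hb, hV, hQ⟩ := h
  refine ⟨hb, hV, fun σ s a j => ?_⟩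
  have := hQ σ s a j
  simp only [noDev, Function.update_eq_self] at this ⊢
  exact this

/-- Values of a continuation policy extend to values of the whole policy. -/
theorem exists_isValueFn_devAfter {G : Game S A n}
    {π : Hist S A n → S → (Fin (n + 1) → A) → ℝ} {i : Fin (n + 1)}
    {ρ : Hist S A n → S → A → A} {V V₁ : Hist S A n → S → Fin (n + 1) → ℝ}
    {Q Q₁ : Hist S A n → S → (Fin (n + 1) → A) → Fin (n + 1) → ℝ}
    (x : S × (Fin (n + 1) → A) × (Fin (n + 1) → A))
    (h : IsValueFn G π i noDev V Q) (h₁ : IsValueFn G (fun τ => π (x :: τ)) i ρ V₁ Q₁) :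
    ∃ V' Q', IsValueFn G π i (devAfter x ρ) V' Q' ∧ ∀ τ, Q' (x :: τ) = Q₁ τ := by
  classical
  obtain ⟨⟨C, hC⟩, hV, hQ⟩ := h
  obtain ⟨⟨C₁, hC₁⟩, hV₁, hQ₁⟩ := h₁
  let V' : Hist S A n → S → Fin (n + 1) → ℝ
    | [] => V []
    | y :: τ => if y = x then V₁ τ else V (y :: τ)
  let Q' : Hist S A n → S → (Fin (n + 1) → A) → Fin (n + 1) → ℝ
    | [] => Q []
    | y :: τ => if y = x then Q₁ τ else Q (y :: τ)
  obtain ⟨V₂, Q₂, h₂, -, hQ₂⟩ := exists_isValueFn_of_cons (G := G) (π := π) (i := i)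
    (ρ := devAfter x ρ) (V := V') (Q := Q') ⟨max C C₁, fun y τ s j => by
      by_cases hy : y = x
      · simpa [V', hy] using Or.inr (hC₁ τ s j)
      · simpa [V', hy] using Or.inl (hC (y :: τ) s j)⟩
    (fun y τ s j => by
      by_cases hy : y = x
      · simpa [V', Q', hy] using hV₁ τ s j
      · simpa [V', Q', hy] using hV (y :: τ) s j)
    (fun y τ s a j => by
      by_cases hy : y = x
      · simpa [V', Q', hy, devAfter] using hQ₁ τ s a j
      · simpa [V', Q', hy, devAfter, noDev] using hQ (y :: τ) s a j)
  exact ⟨V₂, Q₂, h₂, fun τ => by rw [hQ₂]; simp [Q']⟩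

variable [DecidableEq A]

theorem IsCE.continuation {G : Game S A n} {δ : ℝ}
    {π : Hist S A n → S → (Fin (n + 1) → A) → ℝ} (hπ : IsCE G δ π)
    {V : Hist S A n → S → Fin (n + 1) → ℝ}
    {Q : Hist S A n → S → (Fin (n + 1) → A) → Fin (n + 1) → ℝ}
    (h : IsValueFn G π 0 noDev V Q) (x : S × (Fin (n + 1) → A) × (Fin (n + 1) → A)) :
    IsCE G δ (fun τ => π (x :: τ)) := by
  refine ⟨fun τ => hπ.1 (x :: τ), fun V₁ Q₁ h₁ i hi ρ Vρ Qρ hρ σ s a => ?_⟩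
  obtain ⟨V₂, Q₂, h₂, hQ₂⟩ := exists_isValueFn_devAfter x h h₁
  obtain ⟨V₃, Q₃, h₃, hQ₃⟩ := exists_isValueFn_devAfter x (h.of_noDev i) hρ
  rw [devAfter_noDev] at h₂
  have := hπ.2 V₂ Q₂ h₂ i hi _ V₃ Q₃ h₃ (x :: σ) s a
  rwa [hQ₂, hQ₃] at this

open Classical in
/-- The plan that deviates only at the initial time, in state `s` on recommendation `a`. -/
noncomputable def devOnce (s : S) (a b : A) : Hist S A n → S → A → A
  | [] => fun t c => if t = s ∧ c = a then b else c
  | _ :: _ => fun _ c => c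

theorem IsCE.icc {G : Game S A n} {π : Hist S A n → S → (Fin (n + 1) → A) → ℝ}
    (hπ : IsCE G 0 π) {V : Hist S A n → S → Fin (n + 1) → ℝ}
    {Q : Hist S A n → S → (Fin (n + 1) → A) → Fin (n + 1) → ℝ}
    (h : IsValueFn G π 0 noDev V Q) (s : S) :
    ICC G s (π [] s) fun a b => V [(s, a, b)] := by
  intro i hi a b
  obtain ⟨⟨C, hC⟩, hV, hQ⟩ := h.of_noDev i
  obtain ⟨V₁, Q₁, h₁, hV₁, -⟩ := exists_isValueFn_of_cons (G := G) (π := π) (i := i)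
    (ρ := devOnce s a b) ⟨C, fun y τ => hC (y :: τ)⟩ (fun y τ => hV (y :: τ))
    (fun y τ => hQ (y :: τ))
  have key := hπ.2 V Q h i hi _ V₁ Q₁ h₁ [] s a
  rw [sub_zero] at key
  convert key using 1
  · refine sum_congr rfl fun av _ => ?_
    rw [hQ]
    simp [noDev]
  · refine sum_congr rfl fun av hav => ?_
    rw [h₁.2.2]
    simp [devOnce, (mem_filter.1 hav).2, hV₁]

theorem Vstar_subset_Phi (G : Game S A n) (s : S) : Vstar G s ⊆ Phi G (Vstar G) s := by
  rintro v ⟨π, V, Q, hπ, h, rfl⟩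
  refine ⟨π [] s, fun a b => V [(s, a, b)], ⟨hπ.1 [] s, hπ.icc h s, fun a b s' => ?_⟩, ?_⟩
  · obtain ⟨⟨C, hC⟩, hV, hQ⟩ := h
    exact ⟨_, fun τ => V ((s, a, b) :: τ), fun τ => Q ((s, a, b) :: τ),
      hπ.continuation ⟨⟨C, hC⟩, hV, hQ⟩ (s, a, b),
      ⟨⟨C, fun τ => hC _⟩, fun τ => hV _, fun τ => hQ _⟩, rfl⟩
  · funext j
    rw [h.2.1]
    refine sum_congr rfl fun a _ => ?_
    rw [h.2.2]
    simp [noDev]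

theorem Vstar_subset_cube {G : Game S A n} (hG : G.Valid) (s : S) : Vstar G s ⊆ cube n := by
  rintro v ⟨π, V, Q, hπ, h, rfl⟩ j
  exact h.abs_le_half hG hπ.1 [] s j

/-! ### Monotonicity of the update maps -/

theorem Phi_mono (G : Game S A n) {VS WS : S → Set (Fin (n + 1) → ℝ)}
    (h : ∀ s, VS s ⊆ WS s) (s : S) : Phi G VS s ⊆ Phi G WS s := by
  rintro v ⟨pb, w, ⟨h1, h2, h3⟩, rfl⟩
  exact ⟨pb, w, ⟨h1, h2, fun a b s' => h s' (h3 a b s')⟩, rfl⟩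

theorem neigh_mono {ξ : ℝ} {X Y : Set (Fin (n + 1) → ℝ)} (h : X ⊆ Y) :
    neigh ξ X ⊆ neigh ξ Y := by
  rintro v ⟨x, hx, hv⟩
  exact ⟨x, h hx, hv⟩

theorem PhiHat_mono (G : Game S A n) (ξ : ℝ) {VS WS : S → Set (Fin (n + 1) → ℝ)}
    (h : ∀ s, VS s ⊆ WS s) (s : S) : PhiHat G ξ VS s ⊆ PhiHat G ξ WS s :=
  convexHull_mono (Set.inter_subset_inter_left _ (neigh_mono (Phi_mono G h s)))

end

/-! ### Grid cells -/

/-- The corners of the grid cell with lower corner `ξ z`. -/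
def cell {n : ℕ} (ξ : ℝ) (z : Fin (n + 1) → ℤ) : Set (Fin (n + 1) → ℝ) :=
  Set.univ.pi fun i => {ξ * z i, ξ * (z i + 1)}

theorem cell_subset_grid {n : ℕ} (ξ : ℝ) (z : Fin (n + 1) → ℤ) : cell ξ z ⊆ grid n ξ := by
  intro v hv i
  rcases hv i trivial with h | h
  · exact ⟨z i, h⟩
  · exact ⟨z i + 1, by simpa using h⟩

theorem mem_convexHull_cell {n : ℕ} {ξ : ℝ} (hξ : 0 < ξ) {z : Fin (n + 1) → ℤ}
    {x : Fin (n + 1) → ℝ} (hx : ∀ i, ξ * z i ≤ x i ∧ x i ≤ ξ * (z i + 1)) :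
    x ∈ convexHull ℝ (cell ξ z) := by
  rw [cell, convexHull_pi]
  intro i _
  change x i ∈ convexHull ℝ _
  rw [convexHull_pair, segment_eq_Icc (by nlinarith)]
  exact hx i

/-- A cell containing a point of `X` has all its corners in `neigh ξ X`. -/
theorem cell_subset_neigh {n : ℕ} {ξ : ℝ} {z : Fin (n + 1) → ℤ} {x : Fin (n + 1) → ℝ}
    {X : Set (Fin (n + 1) → ℝ)} (hxX : x ∈ X)
    (hx : ∀ i, ξ * z i ≤ x i ∧ x i ≤ ξ * (z i + 1)) : cell ξ z ⊆ neigh ξ X := by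
  refine fun v hv => ⟨x, hxX, fun i => ?_⟩
  obtain ⟨h1, h2⟩ := hx i
  rw [abs_le]
  rcases hv i trivial with h | h
  · rw [h]; constructor <;> linarith
  · rw [Set.mem_singleton_iff] at h
    rw [h]; constructor <;> linarith

theorem subset_convexHull_neigh_inter_grid {n : ℕ} {ξ : ℝ} (hξ : 0 < ξ)
    (X : Set (Fin (n + 1) → ℝ)) : X ⊆ convexHull ℝ (neigh ξ X ∩ grid n ξ) := by
  intro x hxX
  have hx : ∀ i, ξ * (⌊x i / ξ⌋ : ℤ) ≤ x i ∧ x i ≤ ξ * ((⌊x i / ξ⌋ : ℤ) + 1) := fun i => by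
    constructor
    · rw [mul_comm, ← le_div_iff₀ hξ]; exact Int.floor_le _
    · rw [mul_comm, ← div_le_iff₀ hξ]; exact (Int.lt_floor_add_one _).le
  exact convexHull_mono (Set.subset_inter (cell_subset_neigh hxX hx) (cell_subset_grid ξ _))
    (mem_convexHull_cell (z := fun i => ⌊x i / ξ⌋) hξ hx)

theorem exists_cell_of_mem_neigh_inter_grid {n : ℕ} {ξ : ℝ} {X : Set (Fin (n + 1) → ℝ)}
    {g : Fin (n + 1) → ℝ} (hg : g ∈ neigh ξ X ∩ grid n ξ) :
    ∃ z, g ∈ cell ξ z ∧ cell ξ z ⊆ neigh ξ X ∩ grid n ξ := by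
  obtain ⟨⟨x, hxX, hx⟩, hgrid⟩ := hg
  have : ∀ i, ∃ k : ℤ, (g i = ξ * k ∨ g i = ξ * (k + 1)) ∧ ξ * k ≤ x i ∧ x i ≤ ξ * (k + 1) := by
    intro i
    obtain ⟨m, hm⟩ := hgrid i
    obtain ⟨h1, h2⟩ := abs_le.1 (hx i)
    rcases le_total (g i) (x i) with h | h
    · exact ⟨m, Or.inl hm, hm ▸ h, by linarith⟩
    · refine ⟨m - 1, Or.inr (by simpa using hm), ?_, ?_⟩ <;> push_cast <;> linarith
  choose z hz using this
  exact ⟨z, fun i _ => (hz i).1,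
    Set.subset_inter (cell_subset_neigh hxX fun i => (hz i).2) (cell_subset_grid ξ z)⟩

/-- The lower corners of the grid cells whose corners lie in `W`. -/
def cells {n : ℕ} (ξ : ℝ) (W : Set (Fin (n + 1) → ℝ)) : Set (Fin (n + 1) → ℤ) :=
  {z | cell ξ z ⊆ W}

theorem cells_mono {n : ℕ} (ξ : ℝ) {W W' : Set (Fin (n + 1) → ℝ)} (h : W ⊆ W') :
    cells ξ W ⊆ cells ξ W' :=
  fun _ hz => Set.Subset.trans hz h

/-- The hull of `neigh ξ X ∩ grid n ξ` is determined by the grid cells it contains. -/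
theorem convexHull_neigh_inter_grid_subset {n : ℕ} {ξ : ℝ} {X W : Set (Fin (n + 1) → ℝ)}
    (hW : Convex ℝ W) (h : cells ξ (convexHull ℝ (neigh ξ X ∩ grid n ξ)) ⊆ cells ξ W) :
    convexHull ℝ (neigh ξ X ∩ grid n ξ) ⊆ W := by
  refine convexHull_min (fun g hg => ?_) hW
  obtain ⟨z, hgz, hz⟩ := exists_cell_of_mem_neigh_inter_grid hg
  exact h (show cell ξ z ⊆ _ from hz.trans (subset_convexHull ℝ _)) hgz

theorem neigh_cube {n : ℕ} {ξ : ℝ} (hξ : 0 ≤ ξ) :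
    neigh ξ (cube n) = Set.univ.pi fun _ => Set.Icc (-(1 / 2 + ξ)) (1 / 2 + ξ) := by
  ext v
  constructor
  · rintro ⟨x, hx, hv⟩ i -
    have h1 := abs_le.1 (hx i)
    have h2 := abs_le.1 (hv i)
    constructor <;> linarith
  · intro hv
    refine ⟨fun i => max (-(1 / 2)) (min (1 / 2) (v i)), fun i => abs_le.2 ⟨le_max_left _ _,
      max_le (by norm_num) (min_le_left _ _)⟩, fun i => ?_⟩
    obtain ⟨h1, h2⟩ := hv i trivial
    beta_reduce
    rcases le_total (v i) (1 / 2) with h | h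
    · rw [min_eq_right h]
      rcases le_total (-(1 / 2)) (v i) with h' | h'
      · rwa [max_eq_right h', sub_self, abs_zero]
      · rw [max_eq_left h', abs_le]; constructor <;> linarith
    · rw [min_eq_left h, max_eq_right (by norm_num), abs_le]; constructor <;> linarith

theorem convex_neigh_cube {n : ℕ} {ξ : ℝ} (hξ : 0 ≤ ξ) : Convex ℝ (neigh ξ (cube n)) := by
  rw [neigh_cube hξ]
  exact convex_pi fun _ _ => convex_Icc _ _

theorem convexHull_neigh_cube_inter_grid {n : ℕ} {ξ : ℝ} (hξ : 0 < ξ) {m : ℕ}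
    (hm : (1 / 2 : ℝ) = m * ξ) :
    convexHull ℝ (neigh ξ (cube n) ∩ grid n ξ) = neigh ξ (cube n) := by
  refine (convexHull_min Set.inter_subset_left (convex_neigh_cube hξ.le)).antisymm ?_
  have hvert : neigh ξ (cube n) =
      convexHull ℝ (Set.univ.pi fun _ => {-(1 / 2 + ξ), 1 / 2 + ξ}) := by
    rw [neigh_cube hξ.le, convexHull_pi]
    congr! 2
    rw [convexHull_pair, segment_eq_Icc (by linarith)]
  conv_lhs => rw [hvert]
  refine convexHull_mono (Set.subset_inter ?_ ?_)
  · rw [hvert]; exact subset_convexHull ℝ _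
  · intro v hv i
    rcases hv i trivial with h | h
    · exact ⟨-(m + 1), by rw [h, hm]; push_cast; ring⟩
    · rw [Set.mem_singleton_iff] at h
      exact ⟨m + 1, by rw [h, hm]; push_cast; ring⟩

theorem cells_neigh_cube_subset {n : ℕ} {ξ : ℝ} (hξ : 0 < ξ) {m : ℕ}
    (hm : (1 / 2 : ℝ) = m * ξ) :
    cells ξ (neigh ξ (cube n)) ⊆
      (Fintype.piFinset fun _ : Fin (n + 1) => Finset.Icc (-(m + 1) : ℤ) m) := by
  intro z hz
  rw [Finset.mem_coe, Fintype.mem_piFinset]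
  rw [neigh_cube hξ.le] at hz
  intro i
  have h1 := (@hz (fun i => ξ * z i) (fun i _ => Or.inl rfl) i trivial).1
  have h2 := (@hz (fun i => ξ * (z i + 1)) (fun i _ => Or.inr rfl) i trivial).2
  rw [Finset.mem_Icc]
  constructor
  · have : ((-(m + 1) : ℤ) : ℝ) ≤ z i := by
      push_cast
      exact le_of_mul_le_mul_left (by linarith) hξ
    exact_mod_cast this
  · have : (z i : ℝ) ≤ (m : ℤ) := by
      push_cast
      exact le_of_mul_le_mul_left (by linarith) hξ
    exact_mod_cast this

theorem ncard_cells_neigh_cube_le {n : ℕ} {ξ : ℝ} (hξ : 0 < ξ) {m : ℕ}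
    (hm : (1 / 2 : ℝ) = m * ξ) :
    (cells ξ (neigh ξ (cube n))).ncard ≤ (2 * m + 2) ^ (n + 1) := by
  refine (Set.ncard_le_ncard (cells_neigh_cube_subset hξ hm) (Finset.finite_toSet _)).trans ?_
  rw [Set.ncard_coe_finset, Fintype.card_piFinset_const, Int.card_Icc]
  exact (congrArg (· ^ (n + 1)) (by omega)).le

theorem grid_abs_le {ξ b x : ℝ} (hξ : 0 < ξ) {m : ℕ} (hm : (1 / 2 : ℝ) = m * ξ)
    (hx : ∃ k : ℤ, x = ξ * k) (hb : |x| ≤ b) (hlt : b < 1 / 2 + 2 * ξ) : |x| ≤ 1 / 2 + ξ := by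
  obtain ⟨k, rfl⟩ := hx
  rw [abs_mul, abs_of_pos hξ] at hb ⊢
  have h1 : |(k : ℝ)| < m + 2 := lt_of_mul_lt_mul_left (by linarith) hξ.le
  have h2 : |k| < m + 2 := by exact_mod_cast h1
  have h3 : (|k| : ℤ) ≤ m + 1 := by omega
  have h4 : |(k : ℝ)| ≤ m + 1 := by exact_mod_cast h3
  nlinarith

theorem PhiHat_neigh_cube_subset {S A : Type*} [Fintype S] [Fintype A] [DecidableEq A] {n : ℕ}
    {G : Game S A n} (hG : G.Valid) {ξ : ℝ} (hξ : 0 < ξ) {m : ℕ} (hm : (1 / 2 : ℝ) = m * ξ)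
    (s : S) : PhiHat G ξ (fun _ => neigh ξ (cube n)) s ⊆ neigh ξ (cube n) := by
  refine convexHull_min ?_ (convex_neigh_cube hξ.le)
  rintro g ⟨⟨x, ⟨pb, w, ⟨hpb, -, hw⟩, rfl⟩, hx⟩, hgrid⟩
  rw [neigh_cube hξ.le] at hw ⊢
  intro i _
  have hB := hG.abs_Bellman_le (s := s) hpb (fun a b s' j => abs_le.2 (hw a b s' j trivial)) i
  have hg : |g i| ≤ 1 / 2 + G.gamma * ξ + ξ := by
    have := abs_add_le (g i - Bellman G s pb w i) (Bellman G s pb w i)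
    rw [sub_add_cancel] at this
    linarith [hx i]
  exact abs_le.1 (grid_abs_le hξ hm (hgrid i) hg (by nlinarith [hG.2.1]))

/-- A natural-number sequence is stationary at some index not exceeding its first term. -/
theorem exists_le_le_succ (f : ℕ → ℕ) : ∃ K ≤ f 0, f K ≤ f (K + 1) := by
  by_contra! h
  have key : ∀ k ≤ f 0 + 1, f k + k ≤ f 0 := by
    intro k
    induction k with
    | zero => simp
    | succ k ih =>
      intro hk
      have := h k (by omega)
      have := ih (by omega)
      omega
  have := key _ le_rfl
  omega

/-- Lemma 4.12: approximate value-set iteration (started from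
`neigh_ξ(B)` and updated by `Φ̂`) is decreasing, reaches a fixed point after at
most `|S|·(1/ξ + 2)^{n+1}` iterations, and the resulting fixed point satisfies
`𝒱 = Φ̂(𝒱)` and contains `𝒱*`. -/
theorem stmt10 {S A : Type*} [Fintype S] [Fintype A] [DecidableEq A] {n : ℕ}
    (G : Game S A n) (hG : G.Valid) (ε δ ξ : ℝ) (hε : 0 < ε) (hδ : 0 < δ)
    (hξ : ξ = (1 - G.gamma) * min ε (δ / 2))
    (hdiv : ∃ m : ℕ, (1 / 2 : ℝ) = (m : ℝ) * ξ)
    (Vseq : ℕ → S → Set (Fin (n + 1) → ℝ))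
    (h0 : ∀ s, Vseq 0 s = neigh ξ (cube n))
    (hsucc : ∀ k, Vseq (k + 1) = PhiHat G ξ (Vseq k)) :
    (∀ k s, Vseq (k + 1) s ⊆ Vseq k s) ∧
    ∃ K : ℕ, (K : ℝ) ≤ (Fintype.card S : ℝ) * (1 / ξ + 2) ^ (n + 1) ∧
      Vseq (K + 1) = Vseq K ∧
      (∀ s, Vseq K s = PhiHat G ξ (Vseq K) s) ∧
      ∀ s, Vstar G s ⊆ Vseq K s := by
  have hξ0 : 0 < ξ := by
    rw [hξ]
    exact mul_pos (by linarith [hG.2.1]) (lt_min hε (by linarith))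
  obtain ⟨m, hm⟩ := hdiv
  have hdec : ∀ k s, Vseq (k + 1) s ⊆ Vseq k s := by
    intro k
    induction k with
    | zero =>
      intro s
      rw [hsucc, funext h0]
      exact PhiHat_neigh_cube_subset hG hξ0 hm s
    | succ k ih =>
      intro s
      rw [hsucc (k + 1), hsucc k]
      rw [hsucc k] at ih
      exact PhiHat_mono G ξ ih s
  have hform : ∀ k s, ∃ X, Vseq k s = convexHull ℝ (neigh ξ X ∩ grid n ξ) := by
    rintro (_ | k) s
    · exact ⟨cube n, by rw [h0, convexHull_neigh_cube_inter_grid hξ0 hm]⟩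
    · exact ⟨_, by rw [hsucc]; rfl⟩
  have hfin : ∀ k s, (cells ξ (Vseq k s)).Finite := by
    intro k s
    refine (Finset.finite_toSet _).subset
      ((cells_mono ξ ?_).trans (cells_neigh_cube_subset hξ0 hm))
    rw [← h0 s]
    exact antitone_nat_of_succ_le (f := fun k => Vseq k s) (fun k => hdec k s) (Nat.zero_le k)
  have hstar : ∀ k s, Vstar G s ⊆ Vseq k s := by
    intro k
    induction k with
    | zero =>
      intro s
      rw [h0]
      exact (Vstar_subset_cube hG s).trans fun v hv => ⟨v, hv, fun i => by simpa using hξ0.le⟩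
    | succ k ih =>
      intro s
      rw [hsucc]
      exact (Vstar_subset_Phi G s).trans ((Phi_mono G ih s).trans
        (subset_convexHull_neigh_inter_grid hξ0 _))
  obtain ⟨K, hK, hle⟩ := exists_le_le_succ fun k => ∑ s, (cells ξ (Vseq k s)).ncard
  have hcard : ∀ s, (cells ξ (Vseq (K + 1) s)).ncard ≤ (cells ξ (Vseq K s)).ncard := fun s =>
    Set.ncard_le_ncard (cells_mono ξ (hdec K s)) (hfin K s)
  have hcells : ∀ s, cells ξ (Vseq K s) ⊆ cells ξ (Vseq (K + 1) s) := by
    intro s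
    have heq := (sum_eq_sum_iff_of_le fun s _ => hcard s).1
      ((sum_le_sum fun s _ => hcard s).antisymm hle) s (mem_univ s)
    exact (Set.eq_of_subset_of_ncard_le (cells_mono ξ (hdec K s)) heq.ge (hfin K s)).ge
  have hfix : Vseq (K + 1) = Vseq K := by
    funext s
    refine (hdec K s).antisymm ?_
    have hconv : Convex ℝ (Vseq (K + 1) s) := by
      rw [hsucc]
      exact convex_convexHull ℝ _
    have hsub := hcells s
    obtain ⟨X, hX⟩ := hform K s
    rw [hX] at hsub ⊢
    exact convexHull_neigh_inter_grid_subset hconv hsub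
  refine ⟨hdec, K, ?_, hfix, fun s => by rw [← hsucc, hfix], hstar K⟩
  have hinv : 1 / ξ = 2 * m := by
    rw [div_eq_iff hξ0.ne']
    linarith
  have hbound : K ≤ Fintype.card S * (2 * m + 2) ^ (n + 1) := by
    refine hK.trans ?_
    simp only [h0, sum_const, card_univ, smul_eq_mul]
    exact Nat.mul_le_mul_left _ (ncard_cells_neigh_cube_le hξ0 hm)
  rw [hinv]
  exact_mod_cast hbound
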